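/- Closeness of the Salerno dynamics to the dNLS dynamics in Darboux coordinates: there exist constants c₀ > 0 and ρ₀ > 0 (depending on ν, γ, N) such that for all 0 < ρ ≤ ρ₀, all ε ∈ (0,1], and all solutions z : ℝ → ℝ^{2N} of ż = J∇K(z) and ζ : ℝ → ℝ^{2N} of ζ̇ = J∇Z⁽⁰⁾(ζ) with ‖z(0)‖ ≤ ρ and ‖ζ(0)‖ ≤ ρ, one has ‖z(t) − ζ(t)‖ ≤ c₀·(‖z(0) − ζ(0)‖ + ρ³) for all times |t| ≤ (ρ² + ε)⁻¹. -/

import Mathlib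

/-- `σ(s) = √((exp s − 1)/s)` for `s ≠ 0`, `σ(0) = 1`. -/
noncomputable def sigmaFun (s : ℝ) : ℝ :=
  if s = 0 then 1 else Real.sqrt ((Real.exp s - 1) / s)

/-- The Salerno Hamiltonian in Cartesian coordinates on the periodic lattice `ℤ/N`. -/
noncomputable def salernoH (ν γ ε : ℝ) (N : ℕ) [NeZero N] (q p : ZMod N → ℝ) : ℝ :=
  (∑ j : ZMod N, (-(γ / (4 * ν ^ 2)) * Real.log (1 + ν * ((q j) ^ 2 + (p j) ^ 2))
      + γ / (4 * ν) * ((q j) ^ 2 + (p j) ^ 2)))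
  + ε * ∑ j : ZMod N, (q (j + 1) * q j + p (j + 1) * p j)

/-- The transformed Salerno Hamiltonian `K = H ∘ Φ`, with `Φ` the componentwise
Darboux transformation, as a function on `(ZMod N → ℝ) × (ZMod N → ℝ)`. -/
noncomputable def Ksal (ν γ ε : ℝ) (N : ℕ) [NeZero N]
    (z : (ZMod N → ℝ) × (ZMod N → ℝ)) : ℝ :=
  salernoH ν γ ε N
    (fun j => z.1 j * sigmaFun (ν * ((z.1 j) ^ 2 + (z.2 j) ^ 2)))
    (fun j => z.2 j * sigmaFun (ν * ((z.1 j) ^ 2 + (z.2 j) ^ 2)))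

/-- The dNLS Hamiltonian `Z⁽⁰⁾` on `(ZMod N → ℝ) × (ZMod N → ℝ)`. -/
noncomputable def Z0ham (γ ε : ℝ) (N : ℕ) [NeZero N]
    (z : (ZMod N → ℝ) × (ZMod N → ℝ)) : ℝ :=
  ∑ j : ZMod N, (γ / 8 * ((z.1 j) ^ 2 + (z.2 j) ^ 2) ^ 2
    + ε * (z.1 (j + 1) * z.1 j + z.2 (j + 1) * z.2 j))

/-- `(Q,P) : ℝ → ℝ^N × ℝ^N` solves the Hamilton equations `ż = J∇F(z)`, i.e.
`q̇_j = ∂F/∂p_j`, `ṗ_j = −∂F/∂q_j`. -/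
def IsHamSol {N : ℕ} [NeZero N] (F : (ZMod N → ℝ) × (ZMod N → ℝ) → ℝ)
    (Q P : ℝ → ZMod N → ℝ) : Prop :=
  ∀ t : ℝ, ∀ j : ZMod N,
    HasDerivAt (fun s => Q s j) (fderiv ℝ F (Q t, P t) (0, Pi.single j 1)) t ∧
    HasDerivAt (fun s => P s j) (-(fderiv ℝ F (Q t, P t) (Pi.single j 1, 0))) t

lemma sigmaFun_eq_sqrt_dslope (s : ℝ) : sigmaFun s = √(dslope Real.exp 0 s) := by
  by_cases hs : s = 0
  · subst hs
    simp [sigmaFun]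
  · rw [dslope_of_ne _ hs, slope_def_field]
    simp [sigmaFun, hs]

lemma dslope_exp_zero_pos (s : ℝ) : 0 < dslope Real.exp 0 s := by
  rcases lt_trichotomy s 0 with hs | rfl | hs
  · rw [dslope_of_ne _ hs.ne, slope_def_field]
    exact div_pos_of_neg_of_neg (by simpa using hs) (by simpa using hs)
  · simp
  · rw [dslope_of_ne _ hs.ne', slope_def_field]
    exact div_pos (by simpa using hs) (by simpa using hs)

lemma contDiff_dslope_exp_zero : ContDiff ℝ 1 (dslope Real.exp 0) := by
  rw [contDiff_iff_contDiffAt]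
  intro s
  by_cases hs : s = 0
  · subst hs
    obtain ⟨p, hp⟩ : AnalyticAt ℝ Real.exp 0 := by fun_prop
    exact (HasFPowerSeriesAt.analyticAt hp.has_fpower_series_dslope_fslope).contDiffAt
  · have h : ContDiffAt ℝ 1 (fun r : ℝ => (Real.exp r - 1) / r) s := by
      fun_prop (disch := exact hs)
    refine h.congr_of_eventuallyEq ?_
    filter_upwards [isOpen_ne.mem_nhds hs] with r hr
    rw [dslope_of_ne _ hr, slope_def_field]
    simp

lemma contDiff_sigmaFun : ContDiff ℝ 1 sigmaFun := by
  rw [funext sigmaFun_eq_sqrt_dslope]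
  exact contDiff_dslope_exp_zero.sqrt fun s => (dslope_exp_zero_pos s).ne'

lemma mul_sigmaFun_sq (s : ℝ) : s * sigmaFun s ^ 2 = Real.exp s - 1 := by
  rw [sigmaFun_eq_sqrt_dslope, Real.sq_sqrt (dslope_exp_zero_pos s).le]
  simpa using sub_smul_dslope Real.exp 0 s

/-- A `C¹` profile with value one at zero is uniformly close to one, with bounded slope, on
`[0, 1]`. -/
lemma ContDiff.exists_bound_deriv_and_sub_one {s : ℝ → ℝ} (hs : ContDiff ℝ 1 s) (h0 : s 0 = 1) :
    ∃ C : ℝ, 0 ≤ C ∧ ∀ u : ℝ, 0 ≤ u → u ≤ 1 → |deriv s u| ≤ C ∧ |s u - 1| ≤ C * u := by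
  obtain ⟨C, hC⟩ := (isCompact_Icc (a := (0 : ℝ)) (b := 1)).exists_bound_of_continuousOn
    (hs.continuous_deriv le_rfl).continuousOn
  refine ⟨C, (norm_nonneg _).trans (hC 0 (by simp)), fun u hu0 hu1 => ⟨hC u ⟨hu0, hu1⟩, ?_⟩⟩
  have h := Convex.norm_image_sub_le_of_norm_deriv_le (f := s) (s := Set.Icc (0 : ℝ) 1)
    (fun x _ => (hs.differentiable one_ne_zero).differentiableAt) hC (convex_Icc 0 1)
    (show (0 : ℝ) ∈ Set.Icc (0 : ℝ) 1 by simp) ⟨hu0, hu1⟩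
  simpa [h0, abs_of_nonneg hu0] using h

/-- Grönwall's inequality, in both time directions, for a homogeneous bound on the derivative. -/
lemma le_mul_exp_of_abs_deriv_le {E E' : ℝ → ℝ} {k : ℝ} (hE : ∀ t, HasDerivAt E (E' t) t)
    (hk : ∀ t, |E' t| ≤ k * E t) (t : ℝ) : E t ≤ E 0 * Real.exp (k * |t|) := by
  rcases le_total 0 t with ht | ht
  · have hd : ∀ r, HasDerivAt (fun r => -(E r * Real.exp (-(k * r))))
        (-(E' r * Real.exp (-(k * r)) + E r * (Real.exp (-(k * r)) * -(k * 1)))) r := fun r =>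
      ((hE r).mul ((hasDerivAt_id r).const_mul k).neg.exp).neg
    have hm := monotone_of_hasDerivAt_nonneg hd (fun r => by
      have h := (abs_le.1 (hk r)).2
      have he := Real.exp_pos (-(k * r))
      simp only [Pi.zero_apply]
      nlinarith) ht
    simp only [mul_zero, neg_zero, Real.exp_zero, mul_one, neg_le_neg_iff] at hm
    rw [abs_of_nonneg ht]
    calc E t = E t * Real.exp (-(k * t)) * Real.exp (k * t) := by
          rw [mul_assoc, ← Real.exp_add]; simp
      _ ≤ _ := by gcongr
  · have hd : ∀ r, HasDerivAt (fun r => E r * Real.exp (k * r))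
        (E' r * Real.exp (k * r) + E r * (Real.exp (k * r) * (k * 1))) r := fun r =>
      (hE r).mul ((hasDerivAt_id r).const_mul k).exp
    have hm := monotone_of_hasDerivAt_nonneg hd (fun r => by
      have h := (abs_le.1 (hk r)).1
      have he := Real.exp_pos (k * r)
      simp only [Pi.zero_apply]
      nlinarith) ht
    simp only [mul_zero, Real.exp_zero, mul_one] at hm
    rw [abs_of_nonpos ht]
    calc E t = E t * Real.exp (k * t) * Real.exp (k * -t) := by
          rw [mul_assoc, ← Real.exp_add]; simp
      _ ≤ _ := by gcongr

section Lattice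

variable {N : ℕ} [NeZero N]

/-- The Hamiltonian with on-site potential `f(r_j²)` and nearest-neighbour coupling, of strength
`ε`, between the rescaled variables `(x_j, y_j) · s(r_j²)`. -/
noncomputable def latticeHam (f s : ℝ → ℝ) (ε : ℝ) (z : (ZMod N → ℝ) × (ZMod N → ℝ)) : ℝ :=
  ∑ j : ZMod N, (f (z.1 j ^ 2 + z.2 j ^ 2) + ε *
    (z.1 (j + 1) * s (z.1 (j + 1) ^ 2 + z.2 (j + 1) ^ 2) * (z.1 j * s (z.1 j ^ 2 + z.2 j ^ 2)) +
      z.2 (j + 1) * s (z.1 (j + 1) ^ 2 + z.2 (j + 1) ^ 2) * (z.2 j * s (z.1 j ^ 2 + z.2 j ^ 2))))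

/-- The partial derivative of `latticeHam` with respect to the coordinate `x_j`. -/
noncomputable def latticeForce (f s : ℝ → ℝ) (ε : ℝ) (x y : ZMod N → ℝ) (j : ZMod N) : ℝ :=
  2 * deriv f (x j ^ 2 + y j ^ 2) * x j + ε *
    ((x (j + 1) * s (x (j + 1) ^ 2 + y (j + 1) ^ 2) +
        x (j - 1) * s (x (j - 1) ^ 2 + y (j - 1) ^ 2)) *
      (s (x j ^ 2 + y j ^ 2) + 2 * x j ^ 2 * deriv s (x j ^ 2 + y j ^ 2)) +
    (y (j + 1) * s (x (j + 1) ^ 2 + y (j + 1) ^ 2) +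
        y (j - 1) * s (x (j - 1) ^ 2 + y (j - 1) ^ 2)) *
      (2 * deriv s (x j ^ 2 + y j ^ 2) * x j * y j))

lemma ZMod.sum_shift_mul_add (X Y : ZMod N → ℝ) :
    ∑ j, X (j + 1) * Y j = ∑ j, X j * Y (j - 1) := by
  rw [← Equiv.sum_comp (Equiv.addRight (1 : ZMod N)) (fun j => X j * Y (j - 1))]
  simp

lemma differentiable_latticeHam {f s : ℝ → ℝ} (hf : Differentiable ℝ f) (hs : Differentiable ℝ s)
    (ε : ℝ) : Differentiable ℝ (latticeHam (N := N) f s ε) := by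
  unfold latticeHam
  fun_prop

lemma fderiv_latticeHam {f s : ℝ → ℝ} (hf : Differentiable ℝ f) (hs : Differentiable ℝ s)
    (ε : ℝ) (x y a b : ZMod N → ℝ) :
    fderiv ℝ (latticeHam f s ε) (x, y) (a, b) =
      ∑ j, (latticeForce f s ε x y j * a j + latticeForce f s ε y x j * b j) := by
  rw [← (differentiable_latticeHam hf hs ε (x, y)).lineDeriv_eq_fderiv]
  refine HasLineDerivAt.lineDeriv ?_
  have hx : ∀ j, HasDerivAt (fun τ : ℝ => x j + τ * a j) (a j) 0 := fun j => by
    simpa using ((hasDerivAt_id (0 : ℝ)).mul_const (a j)).const_add (x j)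
  have hy : ∀ j, HasDerivAt (fun τ : ℝ => y j + τ * b j) (b j) 0 := fun j => by
    simpa using ((hasDerivAt_id (0 : ℝ)).mul_const (b j)).const_add (y j)
  have hu : ∀ j, HasDerivAt (fun τ : ℝ => (x j + τ * a j) ^ 2 + (y j + τ * b j) ^ 2)
      (2 * (x j * a j + y j * b j)) 0 := fun j => by
    refine (((hx j).pow 2).add ((hy j).pow 2)).congr_deriv ?_
    simp
    ring
  have hcomp : ∀ {g : ℝ → ℝ}, Differentiable ℝ g → ∀ j,
      HasDerivAt (fun τ : ℝ => g ((x j + τ * a j) ^ 2 + (y j + τ * b j) ^ 2))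
        (deriv g (x j ^ 2 + y j ^ 2) * (2 * (x j * a j + y j * b j))) 0 := fun {g} hg j => by
    have h := (hg ((x j + 0 * a j) ^ 2 + (y j + 0 * b j) ^ 2)).hasDerivAt.comp (0 : ℝ) (hu j)
    simpa [Function.comp_def] using h
  have hX := fun j => (hx j).mul (hcomp hs j)
  have hY := fun j => (hy j).mul (hcomp hs j)
  have hsum := HasDerivAt.fun_sum (u := Finset.univ) fun (j : ZMod N) _ =>
    (hcomp hf j).add ((((hX (j + 1)).mul (hX j)).add ((hY (j + 1)).mul (hY j))).const_mul ε)
  unfold HasLineDerivAt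
  refine (hsum.congr_deriv ?_).congr_of_eventuallyEq (Filter.Eventually.of_forall fun τ => ?_)
  · simp only [zero_mul, add_zero, Pi.mul_apply]
    set X : ZMod N → ℝ := fun j => x j * s (x j ^ 2 + y j ^ 2) with hXd
    set Y : ZMod N → ℝ := fun j => y j * s (x j ^ 2 + y j ^ 2) with hYd
    set DX : ZMod N → ℝ := fun j => a j * s (x j ^ 2 + y j ^ 2) +
      x j * (deriv s (x j ^ 2 + y j ^ 2) * (2 * (x j * a j + y j * b j))) with hDX
    set DY : ZMod N → ℝ := fun j => b j * s (x j ^ 2 + y j ^ 2) +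
      y j * (deriv s (x j ^ 2 + y j ^ 2) * (2 * (x j * a j + y j * b j))) with hDY
    have e1 := ZMod.sum_shift_mul_add DX X
    have e2 := ZMod.sum_shift_mul_add DY Y
    trans ∑ j, (deriv f (x j ^ 2 + y j ^ 2) * (2 * (x j * a j + y j * b j)) +
        ε * (X (j + 1) * DX j + Y (j + 1) * DY j)) +
        ε * (∑ j, DX (j + 1) * X j + ∑ j, DY (j + 1) * Y j)
    · rw [← Finset.sum_add_distrib, Finset.mul_sum, ← Finset.sum_add_distrib]
      exact Finset.sum_congr rfl fun j _ => by simp only [hXd, hYd, hDX, hDY]; ring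
    · rw [e1, e2, ← Finset.sum_add_distrib, Finset.mul_sum, ← Finset.sum_add_distrib]
      refine Finset.sum_congr rfl fun j _ => ?_
      simp only [hXd, hYd, hDX, hDY, latticeForce, add_comm (y _ ^ 2) (x _ ^ 2)]
      ring
  · simp [latticeHam]

lemma IsHamSol.hasDerivAt_latticeHam {f s : ℝ → ℝ} (hf : Differentiable ℝ f)
    (hs : Differentiable ℝ s) {ε : ℝ} {Q P : ℝ → ZMod N → ℝ}
    (h : IsHamSol (latticeHam f s ε) Q P) (t : ℝ) (j : ZMod N) :
    HasDerivAt (fun r => Q r j) (latticeForce f s ε (P t) (Q t) j) t ∧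
      HasDerivAt (fun r => P r j) (-latticeForce f s ε (Q t) (P t) j) t := by
  have h' := h t j
  simpa [fderiv_latticeHam hf hs, Pi.single_apply] using h'

/-- Gauge invariance: the force is tangent to the spheres centred at the origin. -/
lemma sum_mul_latticeForce (f s : ℝ → ℝ) (ε : ℝ) (x y : ZMod N → ℝ) :
    ∑ j, (x j * latticeForce f s ε y x j - y j * latticeForce f s ε x y j) = 0 := by
  set X : ZMod N → ℝ := fun j => x j * s (x j ^ 2 + y j ^ 2) with hXd
  set Y : ZMod N → ℝ := fun j => y j * s (x j ^ 2 + y j ^ 2) with hYd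
  trans ε * (∑ j, Y (j + 1) * X j - ∑ j, Y j * X (j - 1)) -
    ε * (∑ j, X (j + 1) * Y j - ∑ j, X j * Y (j - 1))
  · rw [← Finset.sum_sub_distrib, ← Finset.sum_sub_distrib, Finset.mul_sum, Finset.mul_sum,
      ← Finset.sum_sub_distrib]
    refine Finset.sum_congr rfl fun j _ => ?_
    simp only [hXd, hYd, latticeForce, add_comm (y _ ^ 2) (x _ ^ 2)]
    ring
  · rw [ZMod.sum_shift_mul_add, ZMod.sum_shift_mul_add]
    ring

lemma IsHamSol.sum_sq_eq {f s : ℝ → ℝ} (hf : Differentiable ℝ f)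
    (hs : Differentiable ℝ s) {ε : ℝ} {Q P : ℝ → ZMod N → ℝ}
    (h : IsHamSol (latticeHam f s ε) Q P) (t : ℝ) :
    ∑ j, (Q t j ^ 2 + P t j ^ 2) = ∑ j, (Q 0 j ^ 2 + P 0 j ^ 2) := by
  have hd : ∀ r, HasDerivAt (fun r => ∑ j, (Q r j ^ 2 + P r j ^ 2)) 0 r := fun r => by
    refine (HasDerivAt.fun_sum (u := Finset.univ) fun j _ =>
      ((h.hasDerivAt_latticeHam hf hs r j).1.pow 2).add
        ((h.hasDerivAt_latticeHam hf hs r j).2.pow 2)).congr_deriv ?_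
    trans 2 * ∑ j, (Q r j * latticeForce f s ε (P r) (Q r) j -
      P r j * latticeForce f s ε (Q r) (P r) j)
    · rw [Finset.mul_sum]
      refine Finset.sum_congr rfl fun j _ => ?_
      simp
      ring
    · rw [sum_mul_latticeForce, mul_zero]
  exact is_const_of_deriv_eq_zero (fun r => (hd r).differentiableAt) (fun r => (hd r).deriv) t 0

/-- The on-site potential of the Salerno model in Darboux coordinates. -/
noncomputable def salernoPotential (ν γ u : ℝ) : ℝ :=
  γ / (4 * ν ^ 2) * (Real.exp (ν * u) - 1 - ν * u)

lemma hasDerivAt_salernoPotential {ν : ℝ} (hν : ν ≠ 0) (γ u : ℝ) :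
    HasDerivAt (salernoPotential ν γ) (γ / (4 * ν) * (Real.exp (ν * u) - 1)) u := by
  have h := ((((hasDerivAt_id u).const_mul ν).exp.sub_const 1).sub
    ((hasDerivAt_id u).const_mul ν)).const_mul (γ / (4 * ν ^ 2))
  refine h.congr_deriv ?_
  simp only [id]
  field_simp

lemma Ksal_eq_latticeHam {ν : ℝ} (hν : ν ≠ 0) (γ ε : ℝ) :
    Ksal ν γ ε N = latticeHam (salernoPotential ν γ) (fun u => sigmaFun (ν * u)) ε := by
  funext z
  unfold Ksal salernoH latticeHam
  rw [Finset.mul_sum, ← Finset.sum_add_distrib]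
  refine Finset.sum_congr rfl fun j _ => ?_
  congr 1
  set u := z.1 j ^ 2 + z.2 j ^ 2 with hu
  have h := mul_sigmaFun_sq (ν * u)
  have h1 : (z.1 j * sigmaFun (ν * u)) ^ 2 + (z.2 j * sigmaFun (ν * u)) ^ 2 =
      (Real.exp (ν * u) - 1) / ν := by
    rw [eq_div_iff hν, ← h, hu]
    ring
  rw [h1, mul_div_cancel₀ _ hν, add_sub_cancel, Real.log_exp, salernoPotential]
  field_simp
  ring

lemma Z0ham_eq_latticeHam (γ ε : ℝ) :
    Z0ham γ ε N = latticeHam (fun u => γ / 8 * u ^ 2) (fun _ => 1) ε := by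
  funext z
  simp [Z0ham, latticeHam]

end Lattice

lemma latticeForce_dNLS {N : ℕ} (γ ε : ℝ) (x y : ZMod N → ℝ) (j : ZMod N) :
    latticeForce (fun u => γ / 8 * u ^ 2) (fun _ => 1) ε x y j =
      γ / 2 * ((x j ^ 2 + y j ^ 2) * x j) + ε * (x (j + 1) + x (j - 1)) := by
  have h : deriv (fun u : ℝ => γ / 8 * u ^ 2) (x j ^ 2 + y j ^ 2) =
      γ / 4 * (x j ^ 2 + y j ^ 2) := by
    simp
    ring
  simp only [latticeForce, h, deriv_const]
  ring

lemma abs_coupling_sub_le {C ρ x y x₁ x₂ y₁ y₂ s₀ s₁ s₂ s' : ℝ} (hC : 0 ≤ C) (hρ : 0 ≤ ρ)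
    (hρ1 : ρ ≤ 1) (hx : |x| ≤ ρ) (hy : |y| ≤ ρ) (hx₁ : |x₁| ≤ ρ) (hx₂ : |x₂| ≤ ρ)
    (hy₁ : |y₁| ≤ ρ) (hy₂ : |y₂| ≤ ρ) (hs₀ : |s₀ - 1| ≤ C * ρ ^ 2) (hs₁ : |s₁ - 1| ≤ C * ρ ^ 2)
    (hs₂ : |s₂ - 1| ≤ C * ρ ^ 2) (hs' : |s'| ≤ C) :
    |(x₁ * s₁ + x₂ * s₂) * (s₀ + 2 * x ^ 2 * s') + (y₁ * s₁ + y₂ * s₂) * (2 * s' * x * y) -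
      (x₁ + x₂)| ≤ (12 * C + 10 * C ^ 2) * ρ ^ 3 := by
  have hρ2 : ρ ^ 2 ≤ 1 := pow_le_one₀ hρ hρ1
  have hCρ : C * ρ ^ 2 ≤ C := mul_le_of_le_one_right hC hρ2
  have habs : ∀ {r : ℝ}, |r - 1| ≤ C * ρ ^ 2 → |r| ≤ 1 + C := fun {r} hr => by
    have := abs_sub_abs_le_abs_sub r 1
    rw [abs_one] at this
    linarith
  have hA : |x₁ * (s₁ - 1) + x₂ * (s₂ - 1)| ≤ ρ * (C * ρ ^ 2) + ρ * (C * ρ ^ 2) := by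
    refine (abs_add_le _ _).trans ?_
    rw [abs_mul, abs_mul]
    gcongr
  have hB : |(s₀ - 1) + 2 * x ^ 2 * s'| ≤ C * ρ ^ 2 + 2 * ρ ^ 2 * C := by
    refine (abs_add_le _ _).trans ?_
    rw [abs_mul, abs_mul, abs_pow, abs_two]
    gcongr
  have hB' : |s₀ + 2 * x ^ 2 * s'| ≤ (1 + C) + 2 * 1 * C := by
    refine (abs_add_le _ _).trans ?_
    rw [abs_mul, abs_mul, abs_pow, abs_two]
    have : |x| ^ 2 ≤ 1 := (pow_le_pow_left₀ (abs_nonneg x) hx 2).trans hρ2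
    gcongr
    exact habs hs₀
  have hY : |y₁ * s₁ + y₂ * s₂| ≤ ρ * (1 + C) + ρ * (1 + C) := by
    refine (abs_add_le _ _).trans ?_
    rw [abs_mul, abs_mul]
    gcongr
    exacts [habs hs₁, habs hs₂]
  have hxy : |2 * s' * x * y| ≤ 2 * C * ρ * ρ := by
    rw [abs_mul, abs_mul, abs_mul, abs_two]
    gcongr
  have hxx : |x₁ + x₂| ≤ ρ + ρ := (abs_add_le _ _).trans (add_le_add hx₁ hx₂)
  calc _ = |(x₁ * (s₁ - 1) + x₂ * (s₂ - 1)) * (s₀ + 2 * x ^ 2 * s') +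
        (x₁ + x₂) * ((s₀ - 1) + 2 * x ^ 2 * s') +
        (y₁ * s₁ + y₂ * s₂) * (2 * s' * x * y)| := by congr 1; ring
    _ ≤ (ρ * (C * ρ ^ 2) + ρ * (C * ρ ^ 2)) * ((1 + C) + 2 * 1 * C) +
        (ρ + ρ) * (C * ρ ^ 2 + 2 * ρ ^ 2 * C) +
        (ρ * (1 + C) + ρ * (1 + C)) * (2 * C * ρ * ρ) := by
      refine (abs_add_three _ _ _).trans ?_
      rw [abs_mul, abs_mul, abs_mul]
      gcongr
    _ = _ := by ring

lemma abs_onsite_sub_le {ν ρ d x y x' y' : ℝ} (γ : ℝ) (hν : 0 < ν) (hνρ : ν * ρ ^ 2 ≤ 1)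
    (hρ : 0 ≤ ρ) (hx : |x| ≤ ρ) (hy : |y| ≤ ρ) (hx' : |x'| ≤ ρ) (hy' : |y'| ≤ ρ)
    (hu : x ^ 2 + y ^ 2 ≤ ρ ^ 2) (hdx : |x - x'| ≤ d) (hdy : |y - y'| ≤ d) :
    |2 * (γ / (4 * ν) * (Real.exp (ν * (x ^ 2 + y ^ 2)) - 1)) * x -
      γ / 2 * ((x' ^ 2 + y' ^ 2) * x')| ≤ |γ| * ν * ρ ^ 5 + 3 * |γ| * ρ ^ 2 * d := by
  set u := x ^ 2 + y ^ 2 with hud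
  have hu0 : 0 ≤ u := by positivity
  have hd : 0 ≤ d := (abs_nonneg _).trans hdx
  have hνu : |ν * u| ≤ 1 := by
    rw [abs_of_nonneg (by positivity)]
    exact (mul_le_mul_of_nonneg_left hu hν.le).trans hνρ
  have hexp := Real.abs_exp_sub_one_sub_id_le hνu
  have hsum : ∀ {a b : ℝ}, |a| ≤ ρ → |b| ≤ ρ → |a + b| ≤ ρ + ρ := fun ha hb =>
    (abs_add_le _ _).trans (add_le_add ha hb)
  have h1 : |γ / (2 * ν) * (Real.exp (ν * u) - 1 - ν * u) * x| ≤
      |γ| / (2 * ν) * (ν * ρ ^ 2) ^ 2 * ρ := by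
    rw [abs_mul, abs_mul, abs_div, abs_of_pos (by positivity : 0 < 2 * ν)]
    gcongr
    exact hexp.trans (by gcongr)
  have h2 : |γ / 2 * (u * (x - x') + x' * ((x + x') * (x - x') + (y + y') * (y - y')))| ≤
      |γ| / 2 * (ρ ^ 2 * d + ρ * ((ρ + ρ) * d + (ρ + ρ) * d)) := by
    rw [abs_mul, abs_div, abs_two]
    refine mul_le_mul_of_nonneg_left ?_ (by positivity)
    refine (abs_add_le _ _).trans ?_
    rw [abs_mul, abs_mul, abs_of_nonneg hu0]
    have h3 : |(x + x') * (x - x') + (y + y') * (y - y')| ≤ (ρ + ρ) * d + (ρ + ρ) * d := by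
      refine (abs_add_le _ _).trans ?_
      rw [abs_mul, abs_mul]
      have := hsum hx hx'
      have := hsum hy hy'
      gcongr
    gcongr
  calc _ = |γ / (2 * ν) * (Real.exp (ν * u) - 1 - ν * u) * x +
        γ / 2 * (u * (x - x') + x' * ((x + x') * (x - x') + (y + y') * (y - y')))| := by
        congr 1
        simp only [hud]
        field_simp
        ring
    _ ≤ |γ| / (2 * ν) * (ν * ρ ^ 2) ^ 2 * ρ +
        |γ| / 2 * (ρ ^ 2 * d + ρ * ((ρ + ρ) * d + (ρ + ρ) * d)) :=
      (abs_add_le _ _).trans (add_le_add h1 h2)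
    _ = |γ| * ν * ρ ^ 5 / 2 + 5 / 2 * |γ| * ρ ^ 2 * d := by
      field_simp
      ring
    _ ≤ _ := by
      have : 0 ≤ |γ| * ν * ρ ^ 5 := by positivity
      have : 0 ≤ |γ| * ρ ^ 2 * d := by positivity
      linarith

/-- The Salerno force at one point and the dNLS force at a nearby point differ by a term of
relative size `ρ² + ε`. -/
lemma abs_latticeForce_sub_le {N : ℕ} [NeZero N] {ν ρ ε C d : ℝ} (γ : ℝ) (hν : 0 < ν)
    (hνρ : ν * ρ ^ 2 ≤ 1) (hρ : 0 ≤ ρ) (hρ1 : ρ ≤ 1) (hε : 0 ≤ ε) (hC : 0 ≤ C)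
    (hσ : ∀ u : ℝ, 0 ≤ u → u ≤ 1 → |deriv (fun r => sigmaFun (ν * r)) u| ≤ C ∧
      |sigmaFun (ν * u) - 1| ≤ C * u)
    {x y x' y' : ZMod N → ℝ} (hu : ∀ j, x j ^ 2 + y j ^ 2 ≤ ρ ^ 2)
    (hu' : ∀ j, x' j ^ 2 + y' j ^ 2 ≤ ρ ^ 2)
    (hdx : ∀ j, |x j - x' j| ≤ d) (hdy : ∀ j, |y j - y' j| ≤ d) (j : ZMod N) :
    |latticeForce (salernoPotential ν γ) (fun u => sigmaFun (ν * u)) ε x y j -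
      latticeForce (fun u => γ / 8 * u ^ 2) (fun _ => 1) ε x' y' j| ≤
      (|γ| * ν + 3 * |γ| + (12 * C + 10 * C ^ 2) + 2) * (ρ ^ 2 + ε) * (d + ρ ^ 3) := by
  have hd : 0 ≤ d := (abs_nonneg _).trans (hdx j)
  have habs : ∀ {a b : ℝ}, a ^ 2 + b ^ 2 ≤ ρ ^ 2 → |a| ≤ ρ ∧ |b| ≤ ρ := fun {a b} h =>
    ⟨abs_le_of_sq_le_sq (by nlinarith [sq_nonneg b]) hρ,
      abs_le_of_sq_le_sq (by nlinarith [sq_nonneg a]) hρ⟩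
  have hρ2 : ρ ^ 2 ≤ 1 := pow_le_one₀ hρ hρ1
  have hs : ∀ i, |sigmaFun (ν * (x i ^ 2 + y i ^ 2)) - 1| ≤ C * ρ ^ 2 := fun i =>
    (hσ _ (by positivity) ((hu i).trans hρ2)).2.trans (mul_le_mul_of_nonneg_left (hu i) hC)
  have h1 := abs_onsite_sub_le γ hν hνρ hρ (habs (hu j)).1 (habs (hu j)).2 (habs (hu' j)).1
    (habs (hu' j)).2 (hu j) (hdx j) (hdy j)
  have h2 := abs_coupling_sub_le hC hρ hρ1 (habs (hu j)).1 (habs (hu j)).2 (habs (hu (j + 1))).1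
    (habs (hu (j - 1))).1 (habs (hu (j + 1))).2 (habs (hu (j - 1))).2 (hs j) (hs (j + 1))
    (hs (j - 1)) (hσ _ (by positivity) ((hu j).trans hρ2)).1
  have h3 : |x (j + 1) + x (j - 1) - (x' (j + 1) + x' (j - 1))| ≤ d + d := by
    rw [add_sub_add_comm]
    exact (abs_add_le _ _).trans (add_le_add (hdx _) (hdx _))
  rw [latticeForce_dNLS, latticeForce, (hasDerivAt_salernoPotential hν.ne' γ _).deriv]
  have split : ∀ p q r₁ r₂ r₃ : ℝ, (p + ε * r₁) - (q + ε * r₃) =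
      (p - q) + ε * (r₁ - r₂) + ε * (r₂ - r₃) := fun p q r₁ r₂ r₃ => by ring
  rw [split _ _ _ (x (j + 1) + x (j - 1)) _]
  refine (abs_add_three _ _ _).trans ?_
  rw [abs_mul ε, abs_mul ε, abs_of_nonneg hε]
  refine (add_le_add_three h1 (mul_le_mul_of_nonneg_left h2 hε)
    (mul_le_mul_of_nonneg_left h3 hε)).trans ?_
  have key : (|γ| * ν + 3 * |γ| + (12 * C + 10 * C ^ 2) + 2) * (ρ ^ 2 + ε) * (d + ρ ^ 3) -
      (|γ| * ν * ρ ^ 5 + 3 * |γ| * ρ ^ 2 * d + ε * ((12 * C + 10 * C ^ 2) * ρ ^ 3) +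
        ε * (d + d)) =
      |γ| * ν * (ρ ^ 2 * d + ε * (d + ρ ^ 3)) + 3 * |γ| * (ρ ^ 5 + ε * (d + ρ ^ 3)) +
      (12 * C + 10 * C ^ 2) * (ρ ^ 2 * (d + ρ ^ 3) + ε * d) +
      2 * (ρ ^ 2 * (d + ρ ^ 3) + ε * ρ ^ 3) := by ring
  rw [← sub_nonneg, key]
  positivity

/-- Closeness of the Salerno dynamics to the dNLS dynamics in Darboux coordinates:
`‖z(t) − ζ(t)‖ ≤ c₀·(‖z(0) − ζ(0)‖ + ρ³)` for `|t| ≤ (ρ²+ε)⁻¹`, for solutions of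
`ż = J∇K(z)` and `ζ̇ = J∇Z⁽⁰⁾(ζ)` with initial data of norm at most `ρ ≤ ρ₀`. -/
theorem stmt15 (ν γ : ℝ) (hν : 0 < ν) (N : ℕ) [NeZero N] (hN : 2 ≤ N) :
    ∃ c₀ > (0 : ℝ), ∃ ρ₀ > (0 : ℝ), ∀ ρ : ℝ, 0 < ρ → ρ ≤ ρ₀ →
      ∀ ε : ℝ, 0 < ε → ε ≤ 1 →
      ∀ Qz Pz Qζ Pζ : ℝ → ZMod N → ℝ,
        IsHamSol (Ksal ν γ ε N) Qz Pz →
        IsHamSol (Z0ham γ ε N) Qζ Pζ →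
        Real.sqrt (∑ j : ZMod N, ((Qz 0 j) ^ 2 + (Pz 0 j) ^ 2)) ≤ ρ →
        Real.sqrt (∑ j : ZMod N, ((Qζ 0 j) ^ 2 + (Pζ 0 j) ^ 2)) ≤ ρ →
        ∀ t : ℝ, |t| ≤ (ρ ^ 2 + ε)⁻¹ →
          Real.sqrt (∑ j : ZMod N, ((Qz t j - Qζ t j) ^ 2 + (Pz t j - Pζ t j) ^ 2))
            ≤ c₀ * (Real.sqrt (∑ j : ZMod N,
                ((Qz 0 j - Qζ 0 j) ^ 2 + (Pz 0 j - Pζ 0 j) ^ 2)) + ρ ^ 3) := by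
  have hs : ContDiff ℝ 1 (fun u => sigmaFun (ν * u)) :=
    contDiff_sigmaFun.comp (contDiff_const.mul contDiff_id)
  obtain ⟨C, hC, hσ⟩ := hs.exists_bound_deriv_and_sub_one (by simp [sigmaFun])
  set L := |γ| * ν + 3 * |γ| + (12 * C + 10 * C ^ 2) + 2 with hL
  have hL0 : 0 ≤ L := by positivity
  refine ⟨Real.exp (8 * N * L), Real.exp_pos _, min 1 ν⁻¹, by positivity, ?_⟩
  intro ρ hρ hρ₀ ε hε _ Q P Q' P' hK hZ h0 h0' t ht
  have hρ1 : ρ ≤ 1 := hρ₀.trans (min_le_left _ _)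
  have hνρ : ν * ρ ^ 2 ≤ 1 := by
    have h : ν * ρ ≤ ν * ν⁻¹ := by gcongr; exact hρ₀.trans (min_le_right _ _)
    rw [mul_inv_cancel₀ hν.ne'] at h
    nlinarith
  rw [Ksal_eq_latticeHam hν.ne'] at hK
  rw [Z0ham_eq_latticeHam] at hZ
  have hfK : Differentiable ℝ (salernoPotential ν γ) := fun u =>
    (hasDerivAt_salernoPotential hν.ne' γ u).differentiableAt
  have hsK : Differentiable ℝ (fun u => sigmaFun (ν * u)) := hs.differentiable one_ne_zero
  have hfZ : Differentiable ℝ (fun u : ℝ => γ / 8 * u ^ 2) := by fun_prop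
  have hsZ : Differentiable ℝ (fun _ : ℝ => (1 : ℝ)) := by fun_prop
  have hsite : ∀ {a b : ZMod N → ℝ} {r : ℝ}, ∑ j, (a j ^ 2 + b j ^ 2) ≤ r →
      ∀ j, a j ^ 2 + b j ^ 2 ≤ r := fun {a b r} h j =>
    (Finset.single_le_sum (f := fun j => a j ^ 2 + b j ^ 2) (fun i _ => by positivity)
      (Finset.mem_univ j)).trans h
  have hu : ∀ r j, Q r j ^ 2 + P r j ^ 2 ≤ ρ ^ 2 := fun r =>
    hsite ((hK.sum_sq_eq hfK hsK r).trans_le ((Real.sqrt_le_left hρ.le).1 h0))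
  have hu' : ∀ r j, Q' r j ^ 2 + P' r j ^ 2 ≤ ρ ^ 2 := fun r =>
    hsite ((hZ.sum_sq_eq hfZ hsZ r).trans_le ((Real.sqrt_le_left hρ.le).1 h0'))
  set D : ℝ → ℝ := fun r => ∑ j, ((Q r j - Q' r j) ^ 2 + (P r j - P' r j) ^ 2) with hD
  have hD0 : ∀ r, 0 ≤ D r := fun r => Finset.sum_nonneg fun j _ => by positivity
  set G : ℝ → ZMod N → ℝ := fun r j =>
    latticeForce (salernoPotential ν γ) (fun u => sigmaFun (ν * u)) ε (P r) (Q r) j -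
      latticeForce (fun u => γ / 8 * u ^ 2) (fun _ => 1) ε (P' r) (Q' r) j with hG
  set F : ℝ → ZMod N → ℝ := fun r j =>
    latticeForce (salernoPotential ν γ) (fun u => sigmaFun (ν * u)) ε (Q r) (P r) j -
      latticeForce (fun u => γ / 8 * u ^ 2) (fun _ => 1) ε (Q' r) (P' r) j with hF
  have hderiv : ∀ r, HasDerivAt (fun r => D r + ρ ^ 6)
      (∑ j, 2 * ((Q r j - Q' r j) * G r j - (P r j - P' r j) * F r j)) r := fun r => by
    refine ((HasDerivAt.fun_sum (u := Finset.univ) fun j _ =>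
      (((hK.hasDerivAt_latticeHam hfK hsK r j).1.sub
          (hZ.hasDerivAt_latticeHam hfZ hsZ r j).1).pow 2).add
        (((hK.hasDerivAt_latticeHam hfK hsK r j).2.sub
          (hZ.hasDerivAt_latticeHam hfZ hsZ r j).2).pow 2)).add_const (ρ ^ 6)).congr_deriv ?_
    refine Finset.sum_congr rfl fun j _ => ?_
    simp only [hF, hG, Pi.sub_apply]
    push_cast
    ring
  have hbound : ∀ r, |∑ j, 2 * ((Q r j - Q' r j) * G r j - (P r j - P' r j) * F r j)| ≤
      8 * N * L * (ρ ^ 2 + ε) * (D r + ρ ^ 6) := fun r => by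
    set d := √(D r) with hd
    have hdd : d ^ 2 = D r := Real.sq_sqrt (hD0 r)
    have hd0 : 0 ≤ d := Real.sqrt_nonneg _
    have hj := hsite (a := fun j => Q r j - Q' r j) (b := fun j => P r j - P' r j) hdd.ge
    have hq : ∀ j, |Q r j - Q' r j| ≤ d := fun j =>
      abs_le_of_sq_le_sq (by nlinarith [hj j, sq_nonneg (P r j - P' r j)]) hd0
    have hp : ∀ j, |P r j - P' r j| ≤ d := fun j =>
      abs_le_of_sq_le_sq (by nlinarith [hj j, sq_nonneg (Q r j - Q' r j)]) hd0
    have hFb := abs_latticeForce_sub_le γ hν hνρ hρ.le hρ1 hε.le hC hσ (hu r) (hu' r) hq hp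
    have hGb := abs_latticeForce_sub_le γ hν hνρ hρ.le hρ1 hε.le hC hσ
      (fun j => (add_comm _ _).trans_le (hu r j)) (fun j => (add_comm _ _).trans_le (hu' r j)) hp hq
    set B := L * (ρ ^ 2 + ε) * (d + ρ ^ 3) with hB
    have hterm : ∀ j ∈ Finset.univ,
        |2 * ((Q r j - Q' r j) * G r j - (P r j - P' r j) * F r j)| ≤ 2 * (d * B + d * B) :=
      fun j _ => by
        rw [abs_mul, abs_two]
        refine mul_le_mul_of_nonneg_left ((abs_sub _ _).trans ?_) two_pos.le
        rw [abs_mul, abs_mul]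
        exact add_le_add (mul_le_mul (hq j) (hGb j) (abs_nonneg _) hd0)
          (mul_le_mul (hp j) (hFb j) (abs_nonneg _) hd0)
    refine ((Finset.abs_sum_le_sum_abs _ _).trans (Finset.sum_le_sum hterm)).trans ?_
    rw [Finset.sum_const, Finset.card_univ, ZMod.card, nsmul_eq_mul, ← hdd]
    calc (N : ℝ) * (2 * (d * B + d * B)) = 4 * N * L * (ρ ^ 2 + ε) * (d * (d + ρ ^ 3)) := by
          rw [hB]; ring
      _ ≤ 4 * N * L * (ρ ^ 2 + ε) * (2 * (d ^ 2 + ρ ^ 6)) := by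
          refine mul_le_mul_of_nonneg_left ?_ (by positivity)
          nlinarith [sq_nonneg (d - ρ ^ 3), sq_nonneg (ρ ^ 3), sq_nonneg d]
      _ = _ := by ring
  have hgron := le_mul_exp_of_abs_deriv_le hderiv hbound t
  have hexp : Real.exp (8 * N * L * (ρ ^ 2 + ε) * |t|) ≤ Real.exp (8 * N * L) := by
    refine Real.exp_le_exp.2 ?_
    rw [mul_assoc]
    refine mul_le_of_le_one_right (by positivity) ?_
    calc (ρ ^ 2 + ε) * |t| ≤ (ρ ^ 2 + ε) * (ρ ^ 2 + ε)⁻¹ := by gcongr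
      _ = 1 := mul_inv_cancel₀ (by positivity)
  have hone : 1 ≤ Real.exp (8 * N * L) := Real.one_le_exp (by positivity)
  refine Real.sqrt_le_iff.2 ⟨by positivity, ?_⟩
  have hsq : √(D 0) ^ 2 = D 0 := Real.sq_sqrt (hD0 0)
  calc D t ≤ D t + ρ ^ 6 := by linarith [pow_pos hρ 6]
    _ ≤ (D 0 + ρ ^ 6) * Real.exp (8 * N * L) :=
      hgron.trans (mul_le_mul_of_nonneg_left hexp (add_nonneg (hD0 0) (by positivity)))
    _ ≤ (√(D 0) + ρ ^ 3) ^ 2 * Real.exp (8 * N * L) ^ 2 := by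
      gcongr
      · nlinarith [mul_nonneg (Real.sqrt_nonneg (D 0)) (pow_pos hρ 3).le]
      · exact le_self_pow₀ hone two_ne_zero
    _ = _ := by ring
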